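/- arXiv:2405.07795 — 4 statements merged into one kernel-verified Lean document; each statement's English description precedes it below -/
import Mathlib

section
/- Let V, W ∈ ℝ^{N×N} be symmetric positive definite matrices, and let μ, ν > 0 satisfy xᵀ W x ≤ μ‖x‖² and xᵀ V x ≥ ν‖x‖² for all x ∈ ℝ^N (i.e., λ_max(W) ≤ μ and λ_min(V) ≥ ν). Then V W^{−1} V is symmetric positive definite and for every x ∈ ℝ^N, xᵀ (V W^{−1} V)^{−1} x ≤ (μ/ν²) ‖x‖². -/
open Matrix

/-- A lower bound `ν` on the quadratic form of `V` makes `V` expand Euclidean lengths by at least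
`ν`. -/
lemma sq_mul_dotProduct_self_le_of_quadratic_lower_bound {n : Type*} [Fintype n]
    {V : Matrix n n ℝ} {ν : ℝ} (hν : 0 ≤ ν) {y : n → ℝ}
    (hy : ν * (y ⬝ᵥ y) ≤ y ⬝ᵥ V.mulVec y) :
    ν ^ 2 * (y ⬝ᵥ y) ≤ V.mulVec y ⬝ᵥ V.mulVec y := by
  have hsq : 0 ≤ (V.mulVec y - ν • y) ⬝ᵥ (V.mulVec y - ν • y) :=
    Finset.sum_nonneg fun i _ => mul_self_nonneg _
  simp only [sub_dotProduct, dotProduct_sub, smul_dotProduct, dotProduct_smul, smul_eq_mul,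
    dotProduct_comm (V.mulVec y) y] at hsq
  nlinarith [mul_le_mul_of_nonneg_left hy hν]

/-- If `V, W` are symmetric positive definite with `λ_max(W) ≤ μ` and
    `λ_min(V) ≥ ν` (expressed through the quadratic forms), then `V W⁻¹ V` is
    symmetric positive definite and
    `xᵀ (V W⁻¹ V)⁻¹ x ≤ (μ/ν²) ‖x‖²` for all `x`. -/
theorem stmt_3 (N : ℕ) (V W : Matrix (Fin N) (Fin N) ℝ)
    (hVsymm : V.IsSymm) (hWsymm : W.IsSymm)
    (hV : V.PosDef) (hW : W.PosDef)
    (μ ν : ℝ) (hμ : 0 < μ) (hν : 0 < ν)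
    (hWmax : ∀ x : Fin N → ℝ, x ⬝ᵥ W.mulVec x ≤ μ * (x ⬝ᵥ x))
    (hVmin : ∀ x : Fin N → ℝ, ν * (x ⬝ᵥ x) ≤ x ⬝ᵥ V.mulVec x) :
    (V * W⁻¹ * V).IsSymm ∧ (V * W⁻¹ * V).PosDef ∧
    ∀ x : Fin N → ℝ, x ⬝ᵥ (V * W⁻¹ * V)⁻¹.mulVec x ≤ (μ / ν ^ 2) * (x ⬝ᵥ x) := by
  have hVdet : IsUnit V.det := (isUnit_iff_isUnit_det V).mp hV.isUnit
  have hWdet : IsUnit W.det := (isUnit_iff_isUnit_det W).mp hW.isUnit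
  have hpos : (V * W⁻¹ * V).PosDef := by
    simpa only [hV.isHermitian.eq] using
      hW.inv.mul_mul_conjTranspose_same (vecMul_injective_of_isUnit hV.isUnit)
  refine ⟨?_, hpos, fun x => ?_⟩
  · simpa only [IsSymm, IsHermitian, conjTranspose_eq_transpose_of_trivial] using hpos.isHermitian
  obtain ⟨y, rfl⟩ : ∃ y, x = V.mulVec y :=
    ⟨V⁻¹.mulVec x, by rw [mulVec_mulVec, mul_nonsing_inv V hVdet, one_mulVec]⟩
  have hform : V.mulVec y ⬝ᵥ (V * W⁻¹ * V)⁻¹.mulVec (V.mulVec y) = y ⬝ᵥ W.mulVec y := by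
    have hinv : V * ((V * W⁻¹ * V)⁻¹ * V) = W := by
      rw [Matrix.mul_inv_rev, Matrix.mul_inv_rev, nonsing_inv_nonsing_inv W hWdet, Matrix.mul_assoc,
        Matrix.mul_assoc, nonsing_inv_mul V hVdet, Matrix.mul_one,
        mul_nonsing_inv_cancel_left V _ hVdet]
    rw [mulVec_mulVec, ← vecMul_transpose, hVsymm.eq, ← dotProduct_mulVec, mulVec_mulVec, hinv]
  rw [hform, div_mul_eq_mul_div, le_div_iff₀ (pow_pos hν 2)]
  have hlen := sq_mul_dotProduct_self_le_of_quadratic_lower_bound hν.le (hVmin y)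
  nlinarith [mul_le_mul_of_nonneg_right (hWmax y) (sq_nonneg ν),
    mul_le_mul_of_nonneg_left hlen hμ.le]
end

section
/- Fix m > 0, α > 0, κ_min > 0, κ_max > 0 and C ≥ 0, and set τ := α² m⁶ / κ_min². For x > τ define D(x) := x κ_min / m − α m² √x and g(x) := ( √( x κ_max + α m² √x ) + C ) / D(x). Then D(x) > 0 for every x > τ, and g is strictly decreasing on (τ, ∞): for all τ < x < y one has g(y) < g(x). -/
lemma mul_sqrt_quadratic_le {k b s t : ℝ} (hb : 0 ≤ b) (hs : 0 ≤ s) (hst : s ≤ t) :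
    s * Real.sqrt (t ^ 2 * k + b * t) ≤ t * Real.sqrt (s ^ 2 * k + b * s) := by
  have ht : 0 ≤ t := hs.trans hst
  rw [← Real.sqrt_sq hs, ← Real.sqrt_sq ht, ← Real.sqrt_mul (sq_nonneg s),
    ← Real.sqrt_mul (sq_nonneg t), Real.sqrt_sq hs, Real.sqrt_sq ht]
  apply Real.sqrt_le_sqrt
  have h : 0 ≤ b * (s * t) * (t - s) := by
    have := sub_nonneg.2 hst
    positivity
  linarith

lemma sqrt_quadratic_add_div_lt {a b k C s t : ℝ} (ha : 0 < a) (hb : 0 < b) (hk : 0 < k)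
    (hC : 0 ≤ C) (hs : 0 < s) (hbs : b < s * a) (hst : s < t) :
    (Real.sqrt (t ^ 2 * k + b * t) + C) / (t * (t * a - b)) <
      (Real.sqrt (s ^ 2 * k + b * s) + C) / (s * (s * a - b)) := by
  have ht : 0 < t := hs.trans hst
  have hD : s * a - b < t * a - b := sub_lt_sub_right (mul_lt_mul_of_pos_right hst ha) b
  have hDs : 0 < s * a - b := sub_pos.2 hbs
  have hDt : 0 < t * a - b := hDs.trans hD
  have hN : s * (Real.sqrt (t ^ 2 * k + b * t) + C) ≤
      t * (Real.sqrt (s ^ 2 * k + b * s) + C) := by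
    rw [mul_add, mul_add]
    exact add_le_add (mul_sqrt_quadratic_le hb.le hs.le hst.le)
      (mul_le_mul_of_nonneg_right hst.le hC)
  have hpos : 0 < t * (Real.sqrt (s ^ 2 * k + b * s) + C) := by positivity
  rw [div_lt_div_iff₀ (by positivity) (by positivity)]
  calc
    _ = s * (Real.sqrt (t ^ 2 * k + b * t) + C) * (s * a - b) := by ring
    _ ≤ t * (Real.sqrt (s ^ 2 * k + b * s) + C) * (s * a - b) :=
      mul_le_mul_of_nonneg_right hN hDs.le
    _ < t * (Real.sqrt (s ^ 2 * k + b * s) + C) * (t * a - b) :=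
      mul_lt_mul_of_pos_left hD hpos
    _ = _ := by ring

/-- The majorant `g(x) = (√(x κ_max + α m² √x) + C) / (x κ_min/m − α m² √x)`
    has positive denominator and is strictly decreasing on `(τ, ∞)`, where
    `τ = α² m⁶ / κ_min²`. -/
theorem stmt_8 (m α κmin κmax C : ℝ)
    (hm : 0 < m) (hα : 0 < α) (hκmin : 0 < κmin) (hκmax : 0 < κmax) (hC : 0 ≤ C) :
    (∀ x : ℝ, α ^ 2 * m ^ 6 / κmin ^ 2 < x → 0 < x * κmin / m - α * m ^ 2 * Real.sqrt x) ∧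
    (∀ x y : ℝ, α ^ 2 * m ^ 6 / κmin ^ 2 < x → x < y →
      (Real.sqrt (y * κmax + α * m ^ 2 * Real.sqrt y) + C) /
          (y * κmin / m - α * m ^ 2 * Real.sqrt y) <
        (Real.sqrt (x * κmax + α * m ^ 2 * Real.sqrt x) + C) /
          (x * κmin / m - α * m ^ 2 * Real.sqrt x)) := by
  have hτ : 0 < α ^ 2 * m ^ 6 / κmin ^ 2 := by positivity
  have hroot : ∀ x : ℝ, α ^ 2 * m ^ 6 / κmin ^ 2 < x →
      α * m ^ 2 < Real.sqrt x * (κmin / m) := by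
    intro x hx
    have h : α * m ^ 3 / κmin < Real.sqrt x := by
      apply Real.lt_sqrt_of_sq_lt
      convert hx using 1
      ring
    rw [div_lt_iff₀ hκmin] at h
    rw [← mul_div_assoc, lt_div_iff₀ hm]
    linarith
  have hden : ∀ x : ℝ, 0 ≤ x → x * κmin / m - α * m ^ 2 * Real.sqrt x =
      Real.sqrt x * (Real.sqrt x * (κmin / m) - α * m ^ 2) := by
    intro x hx
    linear_combination (-(κmin / m)) * Real.sq_sqrt hx
  refine ⟨fun x hx => ?_, fun x y hx hxy => ?_⟩
  · have hx0 : 0 < x := hτ.trans hx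
    rw [hden x hx0.le]
    exact mul_pos (Real.sqrt_pos.2 hx0) (sub_pos.2 (hroot x hx))
  · have hx0 : 0 < x := hτ.trans hx
    have hy0 : 0 < y := hx0.trans hxy
    have h := sqrt_quadratic_add_div_lt (a := κmin / m) (by positivity)
      (by positivity : 0 < α * m ^ 2) hκmax hC (Real.sqrt_pos.2 hx0) (hroot x hx)
      (Real.sqrt_lt_sqrt hx0.le hxy)
    rwa [Real.sq_sqrt hx0.le, Real.sq_sqrt hy0.le, ← hden x hx0.le, ← hden y hy0.le] at h
end

section
/- Fix m ≥ 1, α > 0, C > 0, and 0 < κ_min ≤ m², and any κ_max > 0; set τ := α² m⁶ / κ_min². Define γ̃(x) := max{ α (m²/C²) √x , α² m²/C² }, γ'(x) := max{ α (m²/C) √x , α² m²/C }, and h(x) := √( x κ_max / C² + γ̃(x) + 1 ) / ( max{ 0 , x κ_min/(C m) − γ'(x) } + 1 ). Define also D(x) := x κ_min/m − α m² √x and g(x) := ( √( x κ_max + α m² √x ) + C ) / D(x). Then for every x > τ, h(x) ≤ g(x). -/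
/-- Beyond the critical point `τ = α² m⁶ / κ_min²`, the ratio bound
    `h(x) = √(x κ_max/C² + γ̃(x) + 1) / (max{0, x κ_min/(Cm) − γ'(x)} + 1)`
    is dominated by the majorant
    `g(x) = (√(x κ_max + α m² √x) + C) / (x κ_min/m − α m² √x)`. -/
theorem stmt_9 (m α C κmin κmax : ℝ)
    (hm : 1 ≤ m) (hα : 0 < α) (hC : 0 < C)
    (hκmin : 0 < κmin) (hκmin' : κmin ≤ m ^ 2) (hκmax : 0 < κmax) :
    ∀ x : ℝ, α ^ 2 * m ^ 6 / κmin ^ 2 < x →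
      Real.sqrt (x * κmax / C ^ 2 +
            max (α * (m ^ 2 / C ^ 2) * Real.sqrt x) (α ^ 2 * m ^ 2 / C ^ 2) + 1) /
          (max 0 (x * κmin / (C * m) -
            max (α * (m ^ 2 / C) * Real.sqrt x) (α ^ 2 * m ^ 2 / C)) + 1) ≤
        (Real.sqrt (x * κmax + α * m ^ 2 * Real.sqrt x) + C) /
          (x * κmin / m - α * m ^ 2 * Real.sqrt x) := by
  intro x hx
  have hm0 : 0 < m := zero_lt_one.trans_le hm
  have hx0 : 0 < x := lt_of_le_of_lt (by positivity) hx
  obtain ⟨s, hs⟩ : ∃ s, s = √x := ⟨_, rfl⟩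
  have hs0 : 0 < s := hs ▸ Real.sqrt_pos.mpr hx0
  have hxs : x = s ^ 2 := by rw [hs, Real.sq_sqrt hx0.le]
  rw [← hs]
  have hcrit : α * m ^ 3 < s * κmin := by
    rw [div_lt_iff₀ (by positivity), hxs] at hx
    refine lt_of_pow_lt_pow_left₀ 2 (by positivity) ?_
    calc (α * m ^ 3) ^ 2 = α ^ 2 * m ^ 6 := by ring
      _ < s ^ 2 * κmin ^ 2 := hx
      _ = (s * κmin) ^ 2 := by ring
  have hαs : α ≤ s := by
    have h : α * m ^ 2 * m < s * m ^ 2 :=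
      calc α * m ^ 2 * m = α * m ^ 3 := by ring
        _ < s * κmin := hcrit
        _ ≤ s * m ^ 2 := by gcongr
    have h' : α * m ^ 2 ≤ α * m ^ 2 * m := le_mul_of_one_le_right (by positivity) hm
    exact (lt_of_mul_lt_mul_right (h'.trans_lt h) (by positivity)).le
  have hsq : α ^ 2 * m ^ 2 ≤ α * m ^ 2 * s := by
    calc α ^ 2 * m ^ 2 = α * m ^ 2 * α := by ring
      _ ≤ α * m ^ 2 * s := by gcongr
  have hmaxNum : max (α * (m ^ 2 / C ^ 2) * s) (α ^ 2 * m ^ 2 / C ^ 2) =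
      α * m ^ 2 * s / C ^ 2 := by
    rw [show α * (m ^ 2 / C ^ 2) * s = α * m ^ 2 * s / C ^ 2 by ring]
    exact max_eq_left (by gcongr)
  have hmaxDen : max (α * (m ^ 2 / C) * s) (α ^ 2 * m ^ 2 / C) = α * m ^ 2 * s / C := by
    rw [show α * (m ^ 2 / C) * s = α * m ^ 2 * s / C by ring]
    exact max_eq_left (by gcongr)
  have hD : 0 < x * κmin / m - α * m ^ 2 * s := by
    rw [sub_pos, lt_div_iff₀ hm0, hxs]
    calc α * m ^ 2 * s * m = s * (α * m ^ 3) := by ring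
      _ < s * (s * κmin) := by gcongr
      _ = s ^ 2 * κmin := by ring
  have hDC : x * κmin / (C * m) - α * m ^ 2 * s / C =
      (x * κmin / m - α * m ^ 2 * s) / C := by
    field_simp
  rw [hmaxNum, hmaxDen, hDC]
  set D := x * κmin / m - α * m ^ 2 * s
  have hA : 0 ≤ x * κmax + α * m ^ 2 * s := by positivity
  rw [← add_div]
  set A := x * κmax + α * m ^ 2 * s
  have hnum : √(A / C ^ 2 + 1) ≤ (√A + C) / C := by
    refine Real.sqrt_le_iff.mpr ⟨by positivity, ?_⟩
    rw [div_pow, div_add_one (by positivity)]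
    gcongr
    nlinarith [Real.sq_sqrt hA, mul_nonneg (Real.sqrt_nonneg A) hC.le]
  have hden : D / C ≤ max 0 (D / C) + 1 :=
    (le_max_right _ _).trans (le_add_of_nonneg_right zero_le_one)
  calc √(A / C ^ 2 + 1) / (max 0 (D / C) + 1) ≤ ((√A + C) / C) / (D / C) := by gcongr
    _ = (√A + C) / D := div_div_div_cancel_right₀ hC.ne' _ _
end

section
/- Fix κ > 0 and τ ≥ 1. Then for every real T ≥ 0: ∫_{4τ}^{T/2 + 4τ} dx / ( √(x κ) − √(τ κ) ) ≤ (2/√κ) · ( √(T/2) + √τ · log( √(T/2) + √τ ) ). -/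
theorem hasDerivAt_sqrt_add_mul_log_sqrt_sub {κ τ x : ℝ} (hκ : 0 < κ) (hτ : 0 ≤ τ)
    (hx : τ < x) :
    HasDerivAt
      (fun y => (2 / Real.sqrt κ) *
        (Real.sqrt y + Real.sqrt τ * Real.log (Real.sqrt y - Real.sqrt τ)))
      (1 / (Real.sqrt (x * κ) - Real.sqrt (τ * κ))) x := by
  have hx0 : 0 < x := hτ.trans_lt hx
  have hs : 0 < Real.sqrt x := Real.sqrt_pos.2 hx0
  have hk : 0 < Real.sqrt κ := Real.sqrt_pos.2 hκ
  have hd : Real.sqrt x - Real.sqrt τ ≠ 0 := (sub_pos.2 (Real.sqrt_lt_sqrt hτ hx)).ne'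
  have h := Real.hasDerivAt_sqrt hx0.ne'
  refine ((h.add (((h.sub_const (Real.sqrt τ)).log hd).const_mul (Real.sqrt τ))).const_mul
    (2 / Real.sqrt κ)).congr_deriv ?_
  rw [Real.sqrt_mul hx0.le, Real.sqrt_mul hτ, ← sub_mul]
  field_simp
  ring

/-- Integral bound for the leading √T term: for `κ > 0`, `τ ≥ 1`, `T ≥ 0`,
    `∫_{4τ}^{T/2+4τ} dx / (√(xκ) − √(τκ)) ≤ (2/√κ)(√(T/2) + √τ log(√(T/2) + √τ))`. -/
theorem stmt_14 (κ τ : ℝ) (hκ : 0 < κ) (hτ : 1 ≤ τ) (T : ℝ) (hT : 0 ≤ T) :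
    (∫ x in (4 * τ)..(T / 2 + 4 * τ),
        1 / (Real.sqrt (x * κ) - Real.sqrt (τ * κ))) ≤
      (2 / Real.sqrt κ) *
        (Real.sqrt (T / 2) + Real.sqrt τ * Real.log (Real.sqrt (T / 2) + Real.sqrt τ)) := by
  have hτ0 : 0 ≤ τ := by linarith
  have hlt : ∀ x ∈ Set.uIcc (4 * τ) (T / 2 + 4 * τ), τ < x := by
    intro x hx
    rw [Set.uIcc_of_le (by linarith)] at hx
    linarith [hx.1]
  have hcont : ContinuousOn (fun x => 1 / (Real.sqrt (x * κ) - Real.sqrt (τ * κ)))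
      (Set.uIcc (4 * τ) (T / 2 + 4 * τ)) := by
    refine ContinuousOn.div continuousOn_const (by fun_prop) fun x hx => ?_
    exact (sub_pos.2 (Real.sqrt_lt_sqrt (by positivity)
      (mul_lt_mul_of_pos_right (hlt x hx) hκ))).ne'
  rw [intervalIntegral.integral_eq_sub_of_hasDerivAt
    (fun x hx => hasDerivAt_sqrt_add_mul_log_sqrt_sub hκ hτ0 (hlt x hx))
    hcont.intervalIntegrable, ← mul_sub]
  refine mul_le_mul_of_nonneg_left ?_ (by positivity)
  have h4 : Real.sqrt (4 * τ) = 2 * Real.sqrt τ := by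
    rw [Real.sqrt_mul (by norm_num), show (4 : ℝ) = 2 ^ 2 by norm_num,
      Real.sqrt_sq (by norm_num)]
  have ha : 1 ≤ Real.sqrt τ := Real.one_le_sqrt.2 hτ
  have hle : Real.sqrt (T / 2 + 4 * τ) ≤ Real.sqrt (T / 2) + 2 * Real.sqrt τ := by
    rw [Real.sqrt_le_left (by positivity)]
    have hS : Real.sqrt (T / 2) ^ 2 = T / 2 := Real.sq_sqrt (by positivity)
    have hsq : Real.sqrt τ ^ 2 = τ := Real.sq_sqrt hτ0
    nlinarith [mul_nonneg (Real.sqrt_nonneg (T / 2)) (Real.sqrt_nonneg τ)]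
  have hge : 2 * Real.sqrt τ ≤ Real.sqrt (T / 2 + 4 * τ) :=
    h4 ▸ Real.sqrt_le_sqrt (by linarith)
  have hlog : Real.log (Real.sqrt (T / 2 + 4 * τ) - Real.sqrt τ) ≤
      Real.log (Real.sqrt (T / 2) + Real.sqrt τ) :=
    Real.log_le_log (by linarith) (by linarith)
  have hmul := mul_le_mul_of_nonneg_left hlog (Real.sqrt_nonneg τ)
  have hnonneg := mul_nonneg (Real.sqrt_nonneg τ) (Real.log_nonneg ha)
  rw [h4, show 2 * Real.sqrt τ - Real.sqrt τ = Real.sqrt τ by ring]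
  linarith
end
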